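/- arXiv:math/0105108 — 2 statements merged into one kernel-verified Lean document; each statement's English description precedes it below -/
import Mathlib

section
/- Let Q be a nondegenerate conic in ℂP², let x₁,…,x₆ be six distinct points of Q, and let A ∉ Q. Then there exists, up to nonzero scalar, exactly one cubic passing through x₁,…,x₆ and singular at A. -/
/-- `f` is singular at the point of `ℂP²` represented by the nonzero vector `v`:
all partial derivatives vanish at `v`. -/
def SingularAt (f : MvPolynomial (Fin 3) ℂ) (v : Fin 3 → ℂ) : Prop :=
  ∀ j : Fin 3, MvPolynomial.eval v (MvPolynomial.pderiv j f) = 0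

open MvPolynomial

namespace MvPolynomial

section Homogeneous

variable {σ R : Type*} [Fintype σ] [CommRing R]

theorem IsHomogeneous.eval_smul {f : MvPolynomial σ R} {n : ℕ} (hf : f.IsHomogeneous n)
    (k : R) (v : σ → R) : eval (k • v) f = k ^ n * eval v f := by
  rw [eval_eq', eval_eq', Finset.mul_sum]
  refine Finset.sum_congr rfl fun m hm => ?_
  have hdeg : ∑ i, m i = n := by
    rw [← Finsupp.degree_eq_sum, hf.degree_eq_sum_deg_support hm, Finsupp.degree_apply]
  simp only [Pi.smul_apply, smul_eq_mul, mul_pow, Finset.prod_mul_distrib,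
    Finset.prod_pow_eq_pow_sum, hdeg]
  ring

theorem IsHomogeneous.natDegree_aeval_le {f : MvPolynomial σ R} {n e : ℕ} (hf : f.IsHomogeneous n)
    {p : σ → Polynomial R} (hp : ∀ i, (p i).natDegree ≤ e) :
    (MvPolynomial.aeval p f).natDegree ≤ n * e := by
  rw [MvPolynomial.aeval_def, eval₂_eq']
  refine Polynomial.natDegree_sum_le_of_forall_le _ _ fun m hm => ?_
  have hdeg : ∑ i, m i = n := by
    rw [← Finsupp.degree_eq_sum, hf.degree_eq_sum_deg_support hm, Finsupp.degree_apply]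
  refine (Polynomial.natDegree_C_mul_le _ _).trans ((Polynomial.natDegree_prod_le _ _).trans ?_)
  rw [← hdeg, Finset.sum_mul]
  exact Finset.sum_le_sum fun i _ =>
    Polynomial.natDegree_pow_le.trans (Nat.mul_le_mul_left _ (hp i))

omit [Fintype σ] in
theorem coeff_prod_pow_of_natDegree_le (s : Finset σ) (m : σ → ℕ) {e : ℕ}
    {p : σ → Polynomial R} (hp : ∀ i, (p i).natDegree ≤ e) :
    (∏ i ∈ s, p i ^ m i).coeff ((∑ i ∈ s, m i) * e) = ∏ i ∈ s, (p i).coeff e ^ m i := by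
  classical
  induction s using Finset.induction_on with
  | empty => simp
  | insert i s hi ih =>
    rw [Finset.prod_insert hi, Finset.sum_insert hi, Finset.prod_insert hi, add_mul,
      Polynomial.coeff_mul_add_eq_of_natDegree_le, ih, Polynomial.coeff_pow_of_natDegree_le (hp i)]
    · exact Polynomial.natDegree_pow_le.trans (Nat.mul_le_mul_left _ (hp i))
    · rw [Finset.sum_mul]
      exact (Polynomial.natDegree_prod_le _ _).trans <| Finset.sum_le_sum fun j _ =>
        Polynomial.natDegree_pow_le.trans (Nat.mul_le_mul_left _ (hp j))

theorem IsHomogeneous.coeff_aeval {f : MvPolynomial σ R} {n e : ℕ} (hf : f.IsHomogeneous n)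
    {p : σ → Polynomial R} (hp : ∀ i, (p i).natDegree ≤ e) :
    (MvPolynomial.aeval p f).coeff (n * e) = eval (fun i => (p i).coeff e) f := by
  rw [MvPolynomial.aeval_def, eval₂_eq', eval_eq', Polynomial.finsetSum_coeff]
  refine Finset.sum_congr rfl fun m hm => ?_
  have hdeg : ∑ i, m i = n := by
    rw [← Finsupp.degree_eq_sum, hf.degree_eq_sum_deg_support hm, Finsupp.degree_apply]
  rw [← hdeg, Polynomial.algebraMap_eq, Polynomial.coeff_C_mul,
    coeff_prod_pow_of_natDegree_le _ _ hp]

theorem eval_aeval_polynomial (f : MvPolynomial σ R) (p : σ → Polynomial R) (s : R) :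
    (aeval p f).eval s = eval (fun i => (p i).eval s) f := by
  rw [MvPolynomial.aeval_def, eval₂_eq', eval_eq', Polynomial.eval_finsetSum]
  simp [Polynomial.eval_prod]

theorem IsHomogeneous.exists_bilinForm {q : MvPolynomial σ ℂ} (hq : q.IsHomogeneous 2) :
    ∃ B : LinearMap.BilinForm ℂ (σ → ℂ), ∀ v, eval v q = B v v := by
  classical
  refine ⟨Matrix.toBilin' (Matrix.of fun i j => (1 / 2 : ℂ) * coeff 0 (pderiv j (pderiv i q))),
    fun v => ?_⟩
  have hconst (i j : σ) : eval v (pderiv j (pderiv i q)) = coeff 0 (pderiv j (pderiv i q)) := by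
    have h : (pderiv j (pderiv i q)).IsHomogeneous 0 := hq.pderiv.pderiv
    rw [← totalDegree_zero_iff_isHomogeneous, totalDegree_eq_zero_iff_eq_C] at h
    conv_lhs => rw [h]
    simp
  have h₁ (i : σ) : ∑ j, v j * eval v (pderiv j (pderiv i q)) = eval v (pderiv i q) := by
    have h := congrArg (eval v) (hq.pderiv (i := i)).sum_X_mul_pderiv
    simpa using h
  have h₂ : ∑ i, v i * eval v (pderiv i q) = 2 * eval v q := by
    have h := congrArg (eval v) hq.sum_X_mul_pderiv
    simpa using h
  simp only [← h₁, hconst] at h₂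
  rw [Matrix.toBilin'_apply]
  have h₃ : eval v q = (1 / 2 : ℂ) * (2 * eval v q) := by ring
  rw [h₃, ← h₂]
  simp only [Finset.mul_sum, Matrix.of_apply]
  exact Finset.sum_congr rfl fun i _ => Finset.sum_congr rfl fun j _ => by ring

omit [Fintype σ] in
/-- A homogeneous multiple of a homogeneous polynomial has a homogeneous cofactor. -/
theorem IsHomogeneous.exists_eq_mul_of_dvd {f g : MvPolynomial σ R} {m n : ℕ}
    (hf : f.IsHomogeneous m) (hg : g.IsHomogeneous (m + n)) (h : f ∣ g) :
    ∃ l : MvPolynomial σ R, l.IsHomogeneous n ∧ g = f * l := by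
  obtain ⟨l, rfl⟩ := h
  refine ⟨homogeneousComponent n l, homogeneousComponent_isHomogeneous n l, ?_⟩
  let _ : GradedAlgebra (homogeneousSubmodule σ R) := MvPolynomial.gradedAlgebra
  have h := DirectSum.coe_decompose_mul_add_of_left_mem (homogeneousSubmodule σ R)
    (i := m) (j := n) (b := l) hf
  rwa [DirectSum.decompose_of_mem_same _ hg,
    show (DirectSum.decompose (homogeneousSubmodule σ R) l n : MvPolynomial σ R) =
      homogeneousComponent n l from decomposition.decompose'_apply l n] at h

theorem IsHomogeneous.eq_zero_of_eval_pderiv {l : MvPolynomial σ R} (hl : l.IsHomogeneous 1)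
    {a : σ → R} (h : ∀ j, eval a (pderiv j l) = 0) : l = 0 := by
  have hd (j : σ) : pderiv j l = 0 := by
    have h₀ : (pderiv j l).IsHomogeneous 0 := hl.pderiv
    rw [← totalDegree_zero_iff_isHomogeneous, totalDegree_eq_zero_iff_eq_C] at h₀
    have h₁ := h j
    rw [h₀, eval_C] at h₁
    rw [h₀, h₁, map_zero]
  simpa [hd] using hl.sum_X_mul_pderiv.symm

theorem finrank_homogeneousSubmodule [Nontrivial R] (n : ℕ) :
    Module.finrank R (homogeneousSubmodule σ R n) = (Fintype.card σ + n - 1).choose n := by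
  classical
  have hset : {d : σ →₀ ℕ | d.degree = n} =
      ((Finset.univ : Finset σ).finsuppAntidiag n : Set (σ →₀ ℕ)) := by
    ext d
    simp [Finset.mem_finsuppAntidiag, Finsupp.degree_eq_sum]
  rw [homogeneousSubmodule_eq_finsupp_supported, hset,
    (AddMonoidAlgebra.supportedEquivFinsupp _).finrank_eq, Module.finrank_finsupp_self]
  simp [Finset.card_finsuppAntidiag_nat_eq_choose]

theorem exists_homogeneous_cubic_singularAt (x : Fin 6 → Fin 3 → ℂ) (a : Fin 3 → ℂ) :
    ∃ c : MvPolynomial (Fin 3) ℂ, c ≠ 0 ∧ c.IsHomogeneous 3 ∧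
      (∀ i, eval (x i) c = 0) ∧ SingularAt c a := by
  let F : MvPolynomial (Fin 3) ℂ →ₗ[ℂ] (Fin 6 → ℂ) × (Fin 3 → ℂ) :=
    (LinearMap.pi fun i => (aeval (x i)).toLinearMap).prod
      (LinearMap.pi fun j => (aeval a).toLinearMap ∘ₗ (pderiv j).toLinearMap)
  have : FiniteDimensional ℂ (homogeneousSubmodule (Fin 3) ℂ 3) :=
    Module.Finite.of_fg (homogeneousSubmodule_fg _ _ 3)
  have hker := LinearMap.ker_ne_bot_of_finrank_lt
    (f := F ∘ₗ (homogeneousSubmodule (Fin 3) ℂ 3).subtype)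
    (by rw [finrank_homogeneousSubmodule]; simp; decide)
  obtain ⟨c, hc, hc0⟩ := (Submodule.ne_bot_iff _).1 hker
  have hF : F c = 0 := hc
  refine ⟨c, by simpa using hc0, c.2, fun i => ?_, fun j => ?_⟩
  · simpa [F, coe_aeval_eq_eval] using congrFun (congrArg Prod.fst hF) i
  · simpa [F, coe_aeval_eq_eval] using congrFun (congrArg Prod.snd hF) j

end Homogeneous

section Conic

variable {q : MvPolynomial (Fin 3) ℂ}

theorem dvd_of_forall_eval_eq_zero {σ : Type*} [Finite σ] {f g : MvPolynomial σ ℂ}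
    (hf : Irreducible f) (h : ∀ y, eval y f = 0 → eval y g = 0) : f ∣ g := by
  have : (Ideal.span {f}).IsPrime := (Ideal.span_singleton_prime hf.ne_zero).2 hf.prime
  rw [← Ideal.mem_span_singleton, ← IsPrime.vanishingIdeal_zeroLocus (K := ℂ) (Ideal.span {f}),
    mem_vanishingIdeal_iff, zeroLocus_span]
  intro y hy
  simpa [coe_aeval_eq_eval] using h y (by simpa [coe_aeval_eq_eval] using hy)

/-- A cubic containing an irreducible conic has no singular point off the conic. -/
theorem eq_zero_of_singularAt_of_vanishes_on_conic (hq : q.IsHomogeneous 2) (hqirr : Irreducible q)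
    {a : Fin 3 → ℂ} (haoff : eval a q ≠ 0) {d : MvPolynomial (Fin 3) ℂ} (hd : d.IsHomogeneous 3)
    (hsing : SingularAt d a) (hvan : ∀ y, eval y q = 0 → eval y d = 0) : d = 0 := by
  obtain ⟨l, hl, rfl⟩ := hq.exists_eq_mul_of_dvd (n := 1) hd
    (dvd_of_forall_eval_eq_zero hqirr hvan)
  have heuler := congrArg (eval a) hd.sum_X_mul_pderiv
  have hsing' (j : Fin 3) : eval a (pderiv j (q * l)) = 0 := hsing j
  simp only [map_sum, map_mul (eval a) (X _), hsing', mul_zero, Finset.sum_const_zero,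
    map_nsmul] at heuler
  have hla : eval a l = 0 := by simpa [haoff] using heuler.symm
  have hl0 : l = 0 := hl.eq_zero_of_eval_pderiv (a := a) fun j => by
    have h := hsing j
    rw [Derivation.leibniz] at h
    simpa [hla, haoff] using h
  rw [hl0, mul_zero]

/-- The restriction of an irreducible conic to a line is nonzero. -/
theorem exists_eval_ne_zero_of_linear (hq : q.IsHomogeneous 2) (hqirr : Irreducible q)
    {l : MvPolynomial (Fin 3) ℂ} (hl : l.IsHomogeneous 1) :
    ∃ y, eval y l = 0 ∧ eval y q ≠ 0 := by
  by_contra! h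
  have hrad : q ∈ (Ideal.span {l}).radical := by
    rw [← vanishingIdeal_zeroLocus_eq_radical (K := ℂ), mem_vanishingIdeal_iff, zeroLocus_span]
    intro y hy
    simpa [coe_aeval_eq_eval] using h y (by simpa [coe_aeval_eq_eval] using hy)
  obtain ⟨n, hn⟩ := hrad
  obtain ⟨i, -, u, hu⟩ := (dvd_prime_pow hqirr.prime n).1 (Ideal.mem_span_singleton.1 hn)
  obtain ⟨k, -, hk⟩ := isUnit_iff_eq_C_of_isReduced.1 u.isUnit
  have hhom : (q ^ i).IsHomogeneous 1 := by
    rw [← hu, hk, mul_comm]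
    exact hl.C_mul k
  have := hhom.inj_right (hq.pow i) (pow_ne_zero _ hqirr.ne_zero)
  omega

theorem exists_isHomogeneous_one_of_linearIndependent {u v : Fin 3 → ℂ}
    (h : LinearIndependent ℂ ![u, v]) :
    ∃ l : MvPolynomial (Fin 3) ℂ, l.IsHomogeneous 1 ∧
      ∀ y, eval y l = 0 → ∃ r s : ℂ, y = r • u + s • v := by
  refine ⟨∑ j, C (crossProduct u v j) * X j,
    IsHomogeneous.sum _ _ _ fun j _ => isHomogeneous_C_mul_X _ j, fun y hy => ?_⟩
  obtain ⟨j, hj⟩ := Function.ne_iff.1 (crossProduct_ne_zero_iff_linearIndependent.2 h)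
  simp only [map_sum, map_mul, eval_C, eval_X] at hy
  have hcramer (p : Fin 3 → ℂ) : (crossProduct u v ⬝ᵥ p) • y =
      (crossProduct y v ⬝ᵥ p) • u + (crossProduct u y ⬝ᵥ p) • v +
        (∑ j, crossProduct u v j * y j) • p := by
    ext i
    fin_cases i <;> simp [cross_apply, dotProduct, Fin.sum_univ_three] <;> ring
  have hc := hcramer (Pi.single j 1)
  rw [hy, zero_smul, add_zero, dotProduct_single_one] at hc
  refine ⟨(crossProduct u v j)⁻¹ * (crossProduct y v ⬝ᵥ Pi.single j 1),
    (crossProduct u v j)⁻¹ * (crossProduct u y ⬝ᵥ Pi.single j 1), ?_⟩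
  rw [mul_smul, mul_smul, ← smul_add, ← hc, inv_smul_smul₀ hj]

theorem polar_ne_zero_of_linearIndependent (hq : q.IsHomogeneous 2) (hqirr : Irreducible q)
    {B : LinearMap.BilinForm ℂ (Fin 3 → ℂ)} (hB : ∀ v, eval v q = B v v)
    {u v : Fin 3 → ℂ} (h : LinearIndependent ℂ ![u, v]) (hu : eval u q = 0) (hv : eval v q = 0) :
    B u v + B v u ≠ 0 := by
  intro h0
  obtain ⟨l, hl, hspan⟩ := exists_isHomogeneous_one_of_linearIndependent h
  obtain ⟨y, hy, hqy⟩ := exists_eval_ne_zero_of_linear hq hqirr hl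
  obtain ⟨r, s, rfl⟩ := hspan y hy
  apply hqy
  rw [hB] at hu hv ⊢
  simp only [map_add, map_smul, LinearMap.add_apply, LinearMap.smul_apply, smul_eq_mul]
  linear_combination r ^ 2 * hu + s ^ 2 * hv + r * s * h0

theorem linearIndependent_pair_of_forall_ne_smul {u v : Fin 3 → ℂ} (hv : v ≠ 0)
    (h : ∀ c : ℂ, u ≠ c • v) : LinearIndependent ℂ ![u, v] := by
  rw [LinearIndependent.pair_symm_iff, LinearIndependent.pair_iff' hv]
  exact fun c hc => h c hc.symm

theorem linearIndependent_of_eval_eq (hq : q.IsHomogeneous 2)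
    {e : Fin 3 → Fin 3 → ℂ} (he : ∀ i, e i ≠ 0) (hon : ∀ i, eval (e i) q = 0)
    {α β γ : ℂ} (hα : α ≠ 0) (hβ : β ≠ 0) (hγ : γ ≠ 0)
    (hexpand : ∀ r s t : ℂ, eval (r • e 0 + s • e 1 + t • e 2) q =
      α * (s * t) + β * (r * t) + γ * (r * s)) :
    LinearIndependent ℂ e := by
  rw [Fintype.linearIndependent_iff]
  intro g hg
  rw [Fin.sum_univ_three] at hg
  have hsmul (i : Fin 3) (c : ℂ) : eval (c • e i) q = 0 := by
    rw [hq.eval_smul, hon, mul_zero]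
  have h01 : g 0 * g 1 = 0 := by
    have h := hexpand (g 0) (g 1) 0
    rw [zero_smul, add_zero, eq_neg_of_add_eq_zero_left hg, ← neg_smul, hsmul] at h
    simpa [hγ] using h.symm
  have h02 : g 0 * g 2 = 0 := by
    have h := hexpand (g 0) 0 (g 2)
    rw [zero_smul, add_zero, show g 0 • e 0 + g 2 • e 2 = (-g 1) • e 1 by
      rw [neg_smul]; linear_combination hg, hsmul] at h
    simpa [hβ] using h.symm
  have h12 : g 1 * g 2 = 0 := by
    have h := hexpand 0 (g 1) (g 2)
    rw [zero_smul, zero_add, show g 1 • e 1 + g 2 • e 2 = (-g 0) • e 0 by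
      rw [neg_smul]; linear_combination hg, hsmul] at h
    simpa [hα] using h.symm
  rw [Fin.forall_fin_succ, Fin.forall_fin_two]
  refine ⟨?_, ?_, ?_⟩ <;> by_contra hi
  · rw [(mul_eq_zero.1 h01).resolve_left hi, (mul_eq_zero.1 h02).resolve_left hi] at hg
    exact hi (by simpa [he] using hg)
  · rw [(mul_eq_zero.1 h01).resolve_right hi, (mul_eq_zero.1 h12).resolve_left hi] at hg
    exact hi (by simpa [he] using hg)
  · rw [(mul_eq_zero.1 h02).resolve_right hi, (mul_eq_zero.1 h12).resolve_right hi] at hg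
    exact hi (by simpa [he] using hg)

theorem exists_eval_smul_add_smul_add_smul (hq : q.IsHomogeneous 2) (hqirr : Irreducible q)
    {e : Fin 3 → Fin 3 → ℂ} (he : ∀ i j, i ≠ j → LinearIndependent ℂ ![e i, e j])
    (hon : ∀ i, eval (e i) q = 0) :
    ∃ α β γ : ℂ, α ≠ 0 ∧ β ≠ 0 ∧ γ ≠ 0 ∧ ∀ r s t : ℂ,
      eval (r • e 0 + s • e 1 + t • e 2) q = α * (s * t) + β * (r * t) + γ * (r * s) := by
  obtain ⟨B, hB⟩ := hq.exists_bilinForm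
  have hne (i j : Fin 3) (hij : i ≠ j) : B (e i) (e j) + B (e j) (e i) ≠ 0 :=
    polar_ne_zero_of_linearIndependent hq hqirr hB (he i j hij) (hon i) (hon j)
  have hB0 (i : Fin 3) : B (e i) (e i) = 0 := by rw [← hB, hon]
  refine ⟨_, _, _, hne 1 2 (by decide), hne 0 2 (by decide), hne 0 1 (by decide),
    fun r s t => ?_⟩
  rw [hB]
  simp only [map_add, map_smul, LinearMap.add_apply, LinearMap.smul_apply, smul_eq_mul, hB0]
  ring

/-- A quadratic parametrization of an irreducible conic through three given points, with the third
of them at infinity. -/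
theorem exists_conic_parametrization (hq : q.IsHomogeneous 2) (hqirr : Irreducible q)
    {e : Fin 3 → Fin 3 → ℂ} (he : ∀ i j, i ≠ j → LinearIndependent ℂ ![e i, e j])
    (hon : ∀ i, eval (e i) q = 0) :
    ∃ (p : Fin 3 → Polynomial ℂ) (b : ℂ), (∀ j, (p j).natDegree ≤ 2) ∧
      (fun j => (p j).coeff 2) = b • e 2 ∧
      ∀ y, eval y q = 0 → (∃ c : ℂ, y = c • e 2) ∨
        ∃ s k : ℂ, y = k • fun j => (p j).eval s := by
  obtain ⟨α, β, γ, hα, hβ, hγ, hexpand⟩ := exists_eval_smul_add_smul_add_smul hq hqirr he hon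
  have hne0 (i : Fin 3) : e i ≠ 0 := by
    obtain ⟨j, hij⟩ := exists_ne i
    exact (he i j hij.symm).ne_zero 0
  have hli : LinearIndependent ℂ e :=
    linearIndependent_of_eval_eq hq hne0 hon hα hβ hγ hexpand
  have hspan (y : Fin 3 → ℂ) : ∃ r s t : ℂ, y = r • e 0 + s • e 1 + t • e 2 := by
    have hy : y ∈ Submodule.span ℂ (Set.range e) := by
      rw [hli.span_eq_top_of_card_eq_finrank' (by simp)]
      exact Submodule.mem_top
    obtain ⟨g, rfl⟩ := (Submodule.mem_span_range_iff_exists_fun ℂ).1 hy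
    exact ⟨g 0, g 1, g 2, Fin.sum_univ_three _⟩
  have hdeg (u v w : ℂ) : (.C u * .X ^ 2 + .C v * .X + .C w : Polynomial ℂ).natDegree ≤ 2 :=
    Polynomial.natDegree_quadratic_le
  refine ⟨fun j => .C (β * e 2 j) * .X ^ 2 + .C (γ * e 2 j + β * e 1 j - α * e 0 j) * .X +
    .C (γ * e 1 j), β, fun j => hdeg _ _ _, ?_, fun y hy => ?_⟩
  · ext j
    simp only [Polynomial.coeff_add, Polynomial.coeff_C_mul,
      Polynomial.coeff_X_pow, Polynomial.coeff_X, Polynomial.coeff_C]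
    simp
  · obtain ⟨r, s, t, rfl⟩ := hspan y
    rw [hexpand] at hy
    by_cases hs : s = 0
    · subst hs
      by_cases hr : r = 0
      · exact Or.inl ⟨t, by simp [hr]⟩
      · right
        have ht : t = 0 := by simpa [hβ, hr] using hy
        refine ⟨-γ / β, r * β / (α * γ), ?_⟩
        ext j
        simp [ht]
        field_simp
        ring
    · right
      have hk : β * t + γ * s ≠ 0 := by
        intro hk
        have hst : s * t = 0 := by
          have : α * (s * t) = 0 := by linear_combination hy - r * hk
          simpa [hα] using this
        have ht : t = 0 := by simpa [hs] using hst
        simp [ht, hγ, hs] at hk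
      obtain ⟨D, hD⟩ : ∃ D, D = β * t + γ * s := ⟨_, rfl⟩
      rw [← hD] at hk
      refine ⟨t / s, s ^ 2 / D, ?_⟩
      ext j
      simp
      field_simp
      linear_combination e 0 j * hy + (r * e 0 j + s * e 1 j + t * e 2 j) * hD

/-- Cubics through six points of an irreducible conic with a given singular point off the conic
are determined by their value at one further point. -/
theorem exists_point_forall_cubic_eq_zero (hq : q.IsHomogeneous 2) (hqirr : Irreducible q)
    {x : Fin 6 → Fin 3 → ℂ} (hx0 : ∀ i, x i ≠ 0)
    (hxdist : ∀ i j, i ≠ j → ∀ c : ℂ, x i ≠ c • x j) (hxon : ∀ i, eval (x i) q = 0)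
    {a : Fin 3 → ℂ} (haoff : eval a q ≠ 0) :
    ∃ z : Fin 3 → ℂ, ∀ d : MvPolynomial (Fin 3) ℂ, d.IsHomogeneous 3 →
      (∀ i, eval (x i) d = 0) → SingularAt d a → eval z d = 0 → d = 0 := by
  obtain ⟨p, b, hp, hp2, hparam⟩ := exists_conic_parametrization hq hqirr
    (e := fun i => x (i.castLE (by decide)))
    (fun i j hij => linearIndependent_pair_of_forall_ne_smul (hx0 _)
      (hxdist _ _ fun h => hij (Fin.castLE_injective _ h)))
    (fun i => hxon _)
  change _ = b • x 2 at hp2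
  change ∀ y, _ → (∃ c : ℂ, y = c • x 2) ∨ _ at hparam
  have hpt (i : Fin 6) : ∃ s k : ℂ, i ≠ 2 → x i = k • fun j => (p j).eval s := by
    by_cases hi : i = 2
    · exact ⟨0, 0, fun h => absurd hi h⟩
    · obtain ⟨c, hc⟩ | ⟨s, k, h⟩ := hparam (x i) (hxon i)
      · exact absurd hc (hxdist i 2 hi c)
      · exact ⟨s, k, fun _ => h⟩
  choose s k hs using hpt
  have hk (i : Fin 6) (hi : i ≠ 2) : k i ≠ 0 := by
    intro h
    apply hx0 i
    rw [hs i hi, h, zero_smul]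
  have hsinj (i j : Fin 6) (hi : i ≠ 2) (hj : j ≠ 2) (h : s i = s j) : i = j := by
    by_contra hij
    apply hxdist i j hij (k i * (k j)⁻¹)
    rw [hs i hi, hs j hj, h, mul_smul, inv_smul_smul₀ (hk j hj)]
  obtain ⟨s₀, hs₀⟩ := Infinite.exists_notMem_finset (Finset.univ.image s)
  have hs₀' (i : Fin 6) : s i ≠ s₀ := fun h => 
    hs₀ (h ▸ Finset.mem_image_of_mem s (Finset.mem_univ i))
  have hinj : Function.Injective (Function.update s 2 s₀) := by
    intro i j h
    by_cases hi : i = 2 <;> by_cases hj : j = 2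
    · rw [hi, hj]
    · subst hi
      rw [Function.update_self, Function.update_of_ne hj] at h
      exact absurd h.symm (hs₀' j)
    · subst hj
      rw [Function.update_self, Function.update_of_ne hi] at h
      exact absurd h (hs₀' i)
    · rw [Function.update_of_ne hi, Function.update_of_ne hj] at h
      exact hsinj i j hi hj h
  refine ⟨fun j => (p j).eval s₀, fun d hd hdx hsing hdz => ?_⟩
  have hdeg := hd.natDegree_aeval_le hp
  have hcoeff : (MvPolynomial.aeval p d).coeff (3 * 2) = 0 := by
    rw [hd.coeff_aeval hp, hp2, hd.eval_smul, hdx, mul_zero]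
  have hP : MvPolynomial.aeval p d = 0 := by
    refine Polynomial.eq_zero_of_natDegree_lt_card_of_eval_eq_zero _ hinj (fun i => ?_) ?_
    · rw [eval_aeval_polynomial]
      by_cases hi : i = 2
      · subst hi
        rwa [Function.update_self]
      · rw [Function.update_of_ne hi]
        have h := hdx i
        rw [hs i hi, hd.eval_smul] at h
        exact (mul_eq_zero.1 h).resolve_left (pow_ne_zero _ (hk i hi))
    · rw [Fintype.card_fin]
      refine lt_of_le_of_ne hdeg fun h => ?_
      have h0 := Polynomial.leadingCoeff_eq_zero.1 ((congrArg _ h).trans hcoeff)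
      simp [h0] at h
  refine eq_zero_of_singularAt_of_vanishes_on_conic hq hqirr haoff hd hsing fun y hy => ?_
  obtain ⟨c, rfl⟩ | ⟨t, c, rfl⟩ := hparam y hy
  · rw [hd.eval_smul, hdx, mul_zero]
  · rw [hd.eval_smul, ← eval_aeval_polynomial, hP, Polynomial.eval_zero, mul_zero]

end Conic

end MvPolynomial

/-- Let `Q` be a nondegenerate (irreducible) conic in `ℂP²`, `x₁,…,x₆` six distinct points
of `Q`, and `A ∉ Q`. Then up to a nonzero scalar there is exactly one cubic passing
through `x₁,…,x₆` and singular at `A`. -/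
theorem stmt_14 (q : MvPolynomial (Fin 3) ℂ)
    (hq : q.IsHomogeneous 2) (hqirr : Irreducible q)
    (x : Fin 6 → (Fin 3 → ℂ)) (hx0 : ∀ i, x i ≠ 0)
    (hxdist : ∀ i j, i ≠ j → ∀ c : ℂ, x i ≠ c • x j)
    (hxon : ∀ i, MvPolynomial.eval (x i) q = 0)
    (a : Fin 3 → ℂ) (ha0 : a ≠ 0) (haoff : MvPolynomial.eval a q ≠ 0) :
    ∃ c : MvPolynomial (Fin 3) ℂ, c ≠ 0 ∧ c.IsHomogeneous 3 ∧
      (∀ i, MvPolynomial.eval (x i) c = 0) ∧ SingularAt c a ∧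
      ∀ c' : MvPolynomial (Fin 3) ℂ, c' ≠ 0 → c'.IsHomogeneous 3 →
        (∀ i, MvPolynomial.eval (x i) c' = 0) → SingularAt c' a →
        ∃ t : ℂ, t ≠ 0 ∧ c' = t • c := by
  obtain ⟨c, hc0, hc, hcx, hca⟩ := exists_homogeneous_cubic_singularAt x a
  obtain ⟨z, hz⟩ := exists_point_forall_cubic_eq_zero hq hqirr hx0 hxdist hxon haoff
  have hcz : eval z c ≠ 0 := fun h => hc0 (hz c hc hcx hca h)
  refine ⟨c, hc0, hc, hcx, hca, fun c' hc0' hc' hcx' hca' => ?_⟩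
  have hcz' : eval z c' ≠ 0 := fun h => hc0' (hz c' hc' hcx' hca' h)
  refine ⟨eval z c' / eval z c, div_ne_zero hcz' hcz, sub_eq_zero.1 ?_⟩
  refine hz _ (hc'.sub ?_) (fun i => ?_) (fun j => ?_) ?_
  · rw [smul_eq_C_mul]
    exact hc.C_mul _
  · simp [smul_eval, hcx, hcx']
  · simp [smul_eval, hca j, hca' j]
  · simp [smul_eval, hcz]
end

section
/- If a plane quintic curve has 5 singular points on a line l, then its defining polynomial has the form f² g where f is a linear form defining l and g is a homogeneous cubic. -/
namespace MvPolynomial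

theorem IsHomogeneous.eval_smul_s15 {σ R : Type*} [CommSemiring R]
    {p : MvPolynomial σ R} {n : ℕ} (hp : p.IsHomogeneous n) (c : R) (x : σ → R) :
    eval (c • x) p = c ^ n * eval x p := by
  simp only [eval_eq, Finset.mul_sum]
  refine Finset.sum_congr rfl fun d hd => ?_
  have hdeg : ∑ i ∈ d.support, d i = n := (hp.degree_eq_sum_deg_support hd).symm
  simp only [Pi.smul_apply, smul_eq_mul, mul_pow, Finset.prod_mul_distrib,
    Finset.prod_pow_eq_pow_sum, hdeg]
  ring

/-- A linear form is the sum of its coefficients times the variables. -/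
theorem IsHomogeneous.exists_eq_sum_C_mul_X {σ R : Type*} [Fintype σ] [CommSemiring R]
    {g : MvPolynomial σ R} (hg : g.IsHomogeneous 1) :
    ∃ a : σ → R, g = ∑ i, C (a i) * X i := by
  have h : ∀ i, ∃ a, pderiv i g = C a := fun i =>
    ⟨_, totalDegree_eq_zero_iff_eq_C.1
      ((totalDegree_zero_iff_isHomogeneous σ).2 (hg.pderiv (i := i)))⟩
  choose a ha using h
  refine ⟨a, ?_⟩
  have := hg.sum_X_mul_pderiv
  rw [one_smul] at this
  rw [← this]
  exact Finset.sum_congr rfl fun i _ => by rw [ha, mul_comm]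

/-- The restriction of `p` to the affine line through `u` with direction `w`. -/
noncomputable def restrictLine {σ R : Type*} [CommRing R] (p : MvPolynomial σ R)
    (u w : σ → R) : Polynomial R :=
  aeval (fun i => Polynomial.C (w i) * Polynomial.X + Polynomial.C (u i)) p

theorem eval_restrictLine {σ R : Type*} [CommRing R] (p : MvPolynomial σ R)
    (u w : σ → R) (t : R) : (p.restrictLine u w).eval t = eval (u + t • w) p := by
  rw [restrictLine, ← Polynomial.coe_evalRingHom, aeval_def, hom_eval₂, eval, coe_eval₂Hom]
  congr 1
  · ext; simp
  · ext i
    simp only [Polynomial.coe_evalRingHom, Polynomial.eval_add, Polynomial.eval_mul,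
      Polynomial.eval_C, Polynomial.eval_X, Pi.add_apply, Pi.smul_apply, smul_eq_mul]
    ring

theorem IsHomogeneous.natDegree_restrictLine_le {σ R : Type*} [CommRing R]
    {p : MvPolynomial σ R} {n : ℕ} (hp : p.IsHomogeneous n) (u w : σ → R) :
    (p.restrictLine u w).natDegree ≤ n := by
  rw [restrictLine]
  refine (aeval_natDegree_le p hp.totalDegree_le _ (n := 1) fun i => ?_).trans_eq (mul_one n)
  exact Polynomial.natDegree_linear_le

/-- If a homogeneous polynomial vanishes on the affine line `u + t w`, it vanishes at the
direction `w`, the point at infinity of that line. -/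
theorem IsHomogeneous.eval_eq_zero_of_forall_add_smul {σ K : Type*} [Field K] [Infinite K]
    {p : MvPolynomial σ K} {n : ℕ} (hp : p.IsHomogeneous n) {u w : σ → K}
    (h : ∀ t : K, eval (u + t • w) p = 0) : eval w p = 0 := by
  have hz : p.restrictLine w u = 0 := by
    refine Polynomial.eq_zero_of_infinite_isRoot _
      ((Set.finite_singleton (0 : K)).infinite_compl.mono fun t ht => ?_)
    have ht : t ≠ 0 := ht
    have : w + t • u = t • (u + t⁻¹ • w) := by
      rw [smul_add, smul_smul, mul_inv_cancel₀ ht, one_smul, add_comm]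
    change Polynomial.eval t _ = 0
    rw [eval_restrictLine, this, hp.eval_smul_s15, h, mul_zero]
  simpa [hz] using (p.eval_restrictLine w u 0).symm

/-- A polynomial vanishing at every zero of a nonzero linear form is divisible by it. -/
theorem IsHomogeneous.dvd_of_forall_eval_eq_zero {σ K : Type*} [Fintype σ]
    [Field K] [Infinite K] {g : MvPolynomial σ K} (hg : g.IsHomogeneous 1) (hg0 : g ≠ 0)
    {p : MvPolynomial σ K} (h : ∀ x, eval x g = 0 → eval x p = 0) : g ∣ p := by
  classical
  obtain ⟨a, rfl⟩ := hg.exists_eq_sum_C_mul_X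
  set g := ∑ i, C (a i) * X i with hgdef
  obtain ⟨k, hk⟩ : ∃ k, a k ≠ 0 := by
    by_contra! hc
    exact hg0 (by simp [hgdef, hc])
  let b : σ → K := Pi.single k (a k)⁻¹
  let s : σ → MvPolynomial σ K := fun i => X i - C (b i) * g
  have hs : MvPolynomial.aeval s p = 0 := by
    refine MvPolynomial.funext fun x => ?_
    have hx : eval x (MvPolynomial.aeval s p) = eval (fun i => eval x (s i)) p := by
      rw [aeval_def, ← coe_eval₂Hom, ← RingHom.comp_apply, eval]
      congr 1
      ext <;> simp
    rw [hx, map_zero]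
    apply h
    simp only [s, hgdef, map_sub, map_sum, map_mul, eval_C, eval_X, mul_sub,
      Finset.sum_sub_distrib, ← mul_assoc, ← Finset.sum_mul]
    simp [b, Pi.single_apply, hk]
  have hcongr : Ideal.Quotient.mk (Ideal.span {g}) (MvPolynomial.aeval s p)
      = Ideal.Quotient.mk (Ideal.span {g}) p := by
    rw [aeval_def, ← coe_eval₂Hom, ← RingHom.comp_apply]
    congr 1
    ext i
    · simp
    · simp only [s, RingHom.comp_apply, coe_eval₂Hom, eval₂_X]
      rw [Ideal.Quotient.mk_eq_mk_iff_sub_mem, Ideal.mem_span_singleton]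
      exact ⟨-C (b i), by ring⟩
  rw [hs, map_zero, eq_comm, Ideal.Quotient.eq_zero_iff_mem, Ideal.mem_span_singleton] at hcongr
  exact hcongr

/-- A homogeneous polynomial of degree `n` in three variables vanishing at more than `n`
points of a projective line is divisible by the linear form defining that line. -/
theorem IsHomogeneous.dvd_of_eval_eq_zero_of_lt_card {K ι : Type*} [Field K] [Infinite K]
    [Fintype ι] {g p : MvPolynomial (Fin 3) K} {n : ℕ}
    (hg : g.IsHomogeneous 1) (hg0 : g ≠ 0) (hp : p.IsHomogeneous n)
    (v : ι → Fin 3 → K) (hv0 : ∀ i, v i ≠ 0) (hdist : ∀ i j, i ≠ j → ∀ c : K, v i ≠ c • v j)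
    (hvg : ∀ i, eval (v i) g = 0) (hvp : ∀ i, eval (v i) p = 0)
    (hcard : n < Fintype.card ι) : g ∣ p := by
  refine hg.dvd_of_forall_eval_eq_zero hg0 fun w hw => ?_
  by_cases hprop : ∃ i, ∃ c : K, w = c • v i
  · obtain ⟨i, c, rfl⟩ := hprop
    rw [hp.eval_smul_s15, hvp, mul_zero]
  push Not at hprop
  obtain ⟨a, rfl⟩ := hg.exists_eq_sum_C_mul_X
  have ha : a ≠ 0 := by
    rintro rfl
    simp at hg0
  simp only [map_sum, map_mul, eval_C, eval_X] at hw hvg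
  obtain ⟨i₀⟩ : Nonempty ι := Fintype.card_pos_iff.1 (by omega)
  have hrel : ∀ i, ∃ t s : K, s ≠ 0 ∧ v i₀ + t • w = s • v i := by
    intro i
    have hdet : (Matrix.of ![v i₀, w, v i]).det = 0 := by
      refine Matrix.exists_mulVec_eq_zero_iff.1 ⟨a, ha, ?_⟩
      ext j
      fin_cases j
      · simpa [Matrix.mulVec, dotProduct, mul_comm] using hvg i₀
      · simpa [Matrix.mulVec, dotProduct, mul_comm] using hw
      · simpa [Matrix.mulVec, dotProduct, mul_comm] using hvg i
    obtain ⟨c, hc, hc0⟩ := Matrix.exists_vecMul_eq_zero_iff.2 hdet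
    have hc0 : c 0 • v i₀ + c 1 • w + c 2 • v i = 0 := by
      rw [Matrix.vecMul_eq_sum] at hc0
      rw [Fin.sum_univ_three] at hc0
      exact hc0
    have h0 : c 0 ≠ 0 := by
      intro h0
      rw [h0, zero_smul, zero_add] at hc0
      by_cases h1 : c 1 = 0
      · rw [h1, zero_smul, zero_add] at hc0
        have h2 := (smul_eq_zero.1 hc0).resolve_right (hv0 i)
        exact hc (by ext j; fin_cases j <;> simp [h0, h1, h2])
      · refine hprop i (-((c 1)⁻¹ * c 2)) ?_
        rw [neg_smul, mul_smul, eq_neg_of_add_eq_zero_right hc0, smul_neg, neg_neg,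
          inv_smul_smul₀ h1]
    have hrel : v i₀ + ((c 0)⁻¹ * c 1) • w = (-((c 0)⁻¹ * c 2)) • v i := by
      rw [neg_smul, mul_smul, mul_smul, eq_neg_of_add_eq_zero_right hc0, smul_neg, neg_neg,
        smul_add, inv_smul_smul₀ h0]
    refine ⟨_, _, fun hs => ?_, hrel⟩
    rw [hs, zero_smul] at hrel
    by_cases ht : (c 0)⁻¹ * c 1 = 0
    · rw [ht, zero_smul, add_zero] at hrel
      exact hv0 i₀ hrel
    · refine hprop i₀ (-((c 0)⁻¹ * c 1)⁻¹) ?_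
      rw [neg_smul, eq_neg_of_add_eq_zero_left hrel, smul_neg, neg_neg, inv_smul_smul₀ ht]
  choose t s hs hts using hrel
  have hinj : Function.Injective t := by
    intro i j hij
    by_contra hne
    refine hdist i j hne ((s i)⁻¹ * s j) ?_
    rw [mul_smul, ← hts j, ← hij, hts i, inv_smul_smul₀ (hs i)]
  have hq : p.restrictLine (v i₀) w = 0 := by
    refine Polynomial.eq_zero_of_natDegree_lt_card_of_eval_eq_zero _ hinj (fun i => ?_)
      ((hp.natDegree_restrictLine_le _ _).trans_lt hcard)
    rw [eval_restrictLine, hts, hp.eval_smul_s15, hvp, mul_zero]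
  refine hp.eval_eq_zero_of_forall_add_smul (u := v i₀) fun x => ?_
  rw [← eval_restrictLine, hq, Polynomial.eval_zero]

/-- The cofactor of a homogeneous divisor of a homogeneous polynomial may be taken
homogeneous. -/
theorem IsHomogeneous.exists_isHomogeneous_of_dvd {σ R : Type*} [CommSemiring R]
    {p q : MvPolynomial σ R} {m n : ℕ} (hp : p.IsHomogeneous (m + n)) (hq : q.IsHomogeneous m)
    (h : q ∣ p) : ∃ r : MvPolynomial σ R, r.IsHomogeneous n ∧ p = q * r := by
  obtain ⟨r, rfl⟩ := h
  let _ : GradedAlgebra (homogeneousSubmodule σ R) := gradedAlgebra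
  refine ⟨DirectSum.decompose (homogeneousSubmodule σ R) r n,
    (DirectSum.decompose (homogeneousSubmodule σ R) r n).2, ?_⟩
  rw [← DirectSum.coe_decompose_mul_add_of_left_mem (homogeneousSubmodule σ R) (i := m) hq]
  exact (DirectSum.decompose_of_mem_same (homogeneousSubmodule σ R) hp).symm

/-- If a linear form `g` divides all partial derivatives of a homogeneous polynomial of
nonzero degree, then `g ^ 2` divides the polynomial. -/
theorem IsHomogeneous.sq_dvd_of_dvd_pderiv {σ K : Type*} [Fintype σ] [Field K] [CharZero K]
    {f g : MvPolynomial σ K} {n : ℕ} (hf : f.IsHomogeneous n) (hn : n ≠ 0)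
    (hg : g.IsHomogeneous 1) (hg0 : g ≠ 0) (h : ∀ j, g ∣ pderiv j f) : g ^ 2 ∣ f := by
  classical
  have hgf : g ∣ f := by
    have h1 : g ∣ n • f := by
      rw [← hf.sum_X_mul_pderiv]
      exact Finset.dvd_sum fun j _ => (h j).mul_left _
    have h2 : f = C (n : K)⁻¹ * (n • f) := by
      rw [nsmul_eq_mul, ← map_natCast (C (σ := σ) (R := K)), ← mul_assoc, ← MvPolynomial.C_mul,
        inv_mul_cancel₀ (Nat.cast_ne_zero.2 hn), C_1, one_mul]
    rw [h2]
    exact h1.mul_left _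
  obtain ⟨f₁, rfl⟩ := hgf
  obtain ⟨a, ha⟩ := hg.exists_eq_sum_C_mul_X
  obtain ⟨k, hk⟩ : ∃ k, a k ≠ 0 := by
    by_contra! hc
    exact hg0 (by simp [ha, hc])
  have hder : pderiv k g = C (a k) := by
    simp [ha, pderiv_X, Pi.single_apply]
  have h1 : g ∣ C (a k) * f₁ := by
    have := h k
    rw [pderiv_mul, hder] at this
    exact (dvd_add_left (dvd_mul_right _ _)).1 this
  have h2 : f₁ = C (a k)⁻¹ * (C (a k) * f₁) := by
    rw [← mul_assoc, ← MvPolynomial.C_mul, inv_mul_cancel₀ hk, C_1, one_mul]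
  rw [sq]
  refine mul_dvd_mul_left g ?_
  rw [h2]
  exact h1.mul_left _

end MvPolynomial


/-- If a plane quintic curve has 5 singular points on a line `l` (defined by the linear
form `g`), then its defining polynomial has the form `g² h` with `h` a homogeneous cubic. -/
theorem stmt_15 (f g : MvPolynomial (Fin 3) ℂ)
    (hf0 : f ≠ 0) (hf : f.IsHomogeneous 5)
    (hg0 : g ≠ 0) (hg : g.IsHomogeneous 1)
    (v : Fin 5 → (Fin 3 → ℂ)) (hv0 : ∀ i, v i ≠ 0)
    (hdist : ∀ i j, i ≠ j → ∀ c : ℂ, v i ≠ c • v j)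
    (honline : ∀ i, MvPolynomial.eval (v i) g = 0)
    (hsing : ∀ i, SingularAt f (v i)) :
    ∃ h : MvPolynomial (Fin 3) ℂ, h.IsHomogeneous 3 ∧ f = g ^ 2 * h := by
  have hdvd : g ^ 2 ∣ f := hf.sq_dvd_of_dvd_pderiv (by norm_num) hg hg0 fun j =>
    hg.dvd_of_eval_eq_zero_of_lt_card hg0 hf.pderiv v hv0 hdist honline
      (fun i => hsing i j) (by simp)
  exact MvPolynomial.IsHomogeneous.exists_isHomogeneous_of_dvd (m := 2) (n := 3) hf
    (hg.pow 2) hdvd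
end
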